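/- arXiv:2212.14423 — 3 statements merged into one kernel-verified Lean document; each statement's English description precedes it below -/
import Mathlib

section
/- Let Ω ⊆ {x ∈ ℝ³ : x₁² + x₂² > 0} be open. Let ρ: Ω → ℝ be differentiable with x₁ ∂₁ρ(x) + x₂ ∂₂ρ(x) = 0 and ∂₃ρ(x) = 0 for all x ∈ Ω (i.e. ρ depends only on the angular variable θ), and let u: Ω → ℝ³ be differentiable with div u = 0 and x₁ u₂(x) − x₂ u₁(x) = 0 for all x ∈ Ω (i.e. u has no e_θ-component). Then div(ρu) = 0 everywhere on Ω. (Mass conservation law for solutions of symmetry type II in cylindrical or spherical coordinates, where the density depends only on the angle θ.) -/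
/-- Partial derivative of a scalar function on ℝ³ in the `i`-th coordinate direction. -/
noncomputable def pd (i : Fin 3) (f : (Fin 3 → ℝ) → ℝ) (x : Fin 3 → ℝ) : ℝ :=
  fderiv ℝ f x (Pi.single i 1)

/-- Euclidean divergence of a vector field on ℝ³: div v = ∂₁v₁ + ∂₂v₂ + ∂₃v₃. -/
noncomputable def div3 (u : (Fin 3 → ℝ) → (Fin 3 → ℝ)) (x : Fin 3 → ℝ) : ℝ :=
  ∑ i, pd i (fun y => u y i) x

/-- Mass conservation law for solutions of symmetry type II where the density depends
only on the angular variable θ: if on an open set `Ω` away from the symmetry axis the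
density `ρ` satisfies `x₁∂₁ρ + x₂∂₂ρ = 0` and `∂₃ρ = 0` (ρ depends only on θ), and the
divergence-free velocity `u` satisfies `x₁u₂ − x₂u₁ = 0` (no `e_θ`-component), then
`div (ρ u) = 0` on `Ω`. -/
theorem symmetry_typeII_angular_mass_conservation
    (Ω : Set (Fin 3 → ℝ)) (hΩopen : IsOpen Ω)
    (hΩ : Ω ⊆ {x : Fin 3 → ℝ | 0 < (x 0) ^ 2 + (x 1) ^ 2})
    (ρ : (Fin 3 → ℝ) → ℝ) (u : (Fin 3 → ℝ) → (Fin 3 → ℝ))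
    (hρ : DifferentiableOn ℝ ρ Ω)
    (hρθ : ∀ x ∈ Ω, x 0 * pd 0 ρ x + x 1 * pd 1 ρ x = 0)
    (hρ3 : ∀ x ∈ Ω, pd 2 ρ x = 0)
    (hu : DifferentiableOn ℝ u Ω)
    (hdiv : ∀ x ∈ Ω, div3 u x = 0)
    (hθ : ∀ x ∈ Ω, x 0 * u x 1 - x 1 * u x 0 = 0) :
    ∀ x ∈ Ω, div3 (fun y => ρ y • u y) x = 0 := by
  intro x hx
  have hn : Ω ∈ nhds x := hΩopen.mem_nhds hx
  have dρ : DifferentiableAt ℝ ρ x := hρ.differentiableAt hn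
  have du : DifferentiableAt ℝ u x := hu.differentiableAt hn
  have key : ∀ i, pd i (fun y => (ρ y • u y) i) x
      = ρ x * pd i (fun y => u y i) x + u x i * pd i ρ x := by
    intro i
    have dui : DifferentiableAt ℝ (fun y => u y i) x := differentiableAt_pi.1 du i
    have h := (dρ.hasFDerivAt.mul dui.hasFDerivAt).fderiv
    have e : (fun y => (ρ y • u y) i) = ρ * (fun y => u y i) := by
      funext y
      simp
    unfold pd
    rw [e, h]
    simp
  have h1 := hρθ x hx
  have h2 := hρ3 x hx
  have h3 := hdiv x hx
  have h4 := hθ x hx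
  have h5 : 0 < (x 0) ^ 2 + (x 1) ^ 2 := hΩ hx
  unfold div3 at h3 ⊢
  rw [Fin.sum_univ_three] at h3 ⊢
  rw [key, key, key, h2]
  have h6 : u x 0 * pd 0 ρ x + u x 1 * pd 1 ρ x = 0 := by
    apply (mul_eq_zero.1 _).resolve_left h5.ne'
    linear_combination (x 0 * u x 0 + x 1 * u x 1) * h1
      + (x 0 * pd 1 ρ x - x 1 * pd 0 ρ x) * h4
  linear_combination ρ x * h3 + h6
end

section
/- Let Ω ⊆ ℝ² be an open convex set and let u = (u₁, u₂): Ω → ℝ² be continuously differentiable with ∂₁u₁ + ∂₂u₂ = 0 on Ω. Then there exists a differentiable function φ: Ω → ℝ (a stream function of u) such that ∂₂φ = u₁ and ∂₁φ = −u₂ on Ω. -/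
/-- Partial derivative of a function of two real variables in the first argument. -/
noncomputable def pd1 (f : ℝ × ℝ → ℝ) (p : ℝ × ℝ) : ℝ := fderiv ℝ f p (1, 0)

/-- Partial derivative of a function of two real variables in the second argument. -/
noncomputable def pd2 (f : ℝ × ℝ → ℝ) (p : ℝ × ℝ) : ℝ := fderiv ℝ f p (0, 1)

/-- Existence of a stream function for a divergence-free planar vector field on an open
convex set: if `∂₁u₁ + ∂₂u₂ = 0` on `Ω`, then there is a differentiable `φ` with
`∂₂φ = u₁` and `∂₁φ = −u₂` on `Ω`. -/
theorem exists_stream_function_planar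
    (Ω : Set (ℝ × ℝ)) (hΩopen : IsOpen Ω) (hΩconv : Convex ℝ Ω)
    (u₁ u₂ : ℝ × ℝ → ℝ)
    (hu₁ : ContDiffOn ℝ 1 u₁ Ω) (hu₂ : ContDiffOn ℝ 1 u₂ Ω)
    (hdiv : ∀ p ∈ Ω, pd1 u₁ p + pd2 u₂ p = 0) :
    ∃ φ : ℝ × ℝ → ℝ, ∀ p ∈ Ω,
      DifferentiableAt ℝ φ p ∧ pd2 φ p = u₁ p ∧ pd1 φ p = -u₂ p := by
  have h1 : ∀ p ∈ Ω, HasFDerivAt u₁ (fderiv ℝ u₁ p) p := fun p hp =>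
    ((hu₁.differentiableOn one_ne_zero).differentiableAt (hΩopen.mem_nhds hp)).hasFDerivAt
  have h2 : ∀ p ∈ Ω, HasFDerivAt u₂ (fderiv ℝ u₂ p) p := fun p hp =>
    ((hu₂.differentiableOn one_ne_zero).differentiableAt (hΩopen.mem_nhds hp)).hasFDerivAt
  have hω : ∀ p ∈ Ω, HasFDerivAt
      (fun p => u₁ p • ContinuousLinearMap.snd ℝ ℝ ℝ - u₂ p • ContinuousLinearMap.fst ℝ ℝ ℝ)
      ((fderiv ℝ u₁ p).smulRight (ContinuousLinearMap.snd ℝ ℝ ℝ)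
        - (fderiv ℝ u₂ p).smulRight (ContinuousLinearMap.fst ℝ ℝ ℝ)) p := fun p hp =>
    ((h1 p hp).smul_const (ContinuousLinearMap.snd ℝ ℝ ℝ)).sub
      ((h2 p hp).smul_const (ContinuousLinearMap.fst ℝ ℝ ℝ))
  have hlin : ∀ (L : ℝ × ℝ →L[ℝ] ℝ) (x : ℝ × ℝ), L x = x.1 * L (1, 0) + x.2 * L (0, 1) := by
    intro L x
    have hx : x = x.1 • ((1, 0) : ℝ × ℝ) + x.2 • ((0, 1) : ℝ × ℝ) := by
      ext <;> simp
    conv_lhs => rw [hx]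
    rw [map_add, map_smul, map_smul, smul_eq_mul, smul_eq_mul]
  obtain ⟨φ, hφ⟩ := hΩconv.exists_forall_hasFDerivAt_of_fderiv_symmetric hΩopen
    (fun p hp => (hω p hp).differentiableAt.differentiableWithinAt) (by
      intro p hp x y
      rw [(hω p hp).fderiv]
      have hd := hdiv p hp
      unfold pd1 pd2 at hd
      simp only [ContinuousLinearMap.sub_apply, ContinuousLinearMap.smulRight_apply,
        ContinuousLinearMap.smul_apply, ContinuousLinearMap.coe_fst', ContinuousLinearMap.coe_snd',
        smul_eq_mul]
      rw [hlin (fderiv ℝ u₁ p) x, hlin (fderiv ℝ u₁ p) y, hlin (fderiv ℝ u₂ p) x,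
        hlin (fderiv ℝ u₂ p) y]
      linear_combination (x.1 * y.2 - y.1 * x.2) * hd)
  refine ⟨φ, fun p hp => ⟨(hφ p hp).differentiableAt, ?_, ?_⟩⟩
  · simp [pd2, (hφ p hp).fderiv]
  · simp [pd1, (hφ p hp).fderiv]
end

section
/- Let η: ℝ → ℝ, m: ℝ → ℝ and v₁, v₂: ℝ → ℝ be continuously differentiable, and let C₁, C₂ ∈ ℝ be constants such that the functions t ↦ m(t) v₁'(t) and t ↦ m(t) v₂'(t) are differentiable with (m v₁')'(t) = C₁ and (m v₂')'(t) = C₂ for all t ∈ ℝ. Define on ℝ³ the velocity u(x) = (v₁(x₃), v₂(x₃), 0), density ρ(x) = η(x₃), viscosity μ(x) = m(x₃), and pressure Π(x) = C₁ x₁ + C₂ x₂. Then (ρ, u, Π) is an exact solution of the stationary inhomogeneous incompressible Navier–Stokes equations with zero external force: for each i = 1,2,3 and all x ∈ ℝ³, Σ_{j=1}^{3} ∂_j(ρ u_i u_j)(x) − Σ_{j=1}^{3} ∂_j(μ (∂_j u_i + ∂_i u_j))(x) + ∂_i Π(x) = 0, together with div u = 0 and div(ρu) = 0. (Explicit solution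 of symmetry type II in Cartesian coordinates.) -/
theorem pd_comp (g : ℝ → ℝ) (hg : Differentiable ℝ g) (j : Fin 3) (x : Fin 3 → ℝ) :
    pd j (fun y => g (y 2)) x = if j = 2 then deriv g (x 2) else 0 := by
  have h1 : HasFDerivAt (fun y : Fin 3 → ℝ => y 2)
      (ContinuousLinearMap.proj (R := ℝ) (φ := fun _ : Fin 3 => ℝ) 2) x :=
    (ContinuousLinearMap.proj (R := ℝ) (φ := fun _ : Fin 3 => ℝ) 2).hasFDerivAt
  have h2 := (hg (x 2)).hasDerivAt.comp_hasFDerivAt x h1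
  have h3 : fderiv ℝ (fun y : Fin 3 → ℝ => g (y 2)) x = _ := h2.fderiv
  unfold pd
  rw [h3]
  fin_cases j <;> simp

theorem pd_zero (j : Fin 3) (x : Fin 3 → ℝ) : pd j (fun _ => (0 : ℝ)) x = 0 := by
  simp [pd]

theorem pd_lin (C₁ C₂ : ℝ) (j : Fin 3) (x : Fin 3 → ℝ) :
    pd j (fun y => C₁ * y 0 + C₂ * y 1) x = ![C₁, C₂, 0] j := by
  have h (k : Fin 3) : HasFDerivAt (fun y : Fin 3 → ℝ => y k)
      (ContinuousLinearMap.proj (R := ℝ) (φ := fun _ : Fin 3 => ℝ) k) x :=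
    (ContinuousLinearMap.proj (R := ℝ) (φ := fun _ : Fin 3 => ℝ) k).hasFDerivAt
  have h3 := (((h 0).const_mul C₁).add ((h 1).const_mul C₂)).fderiv
  have h4 : fderiv ℝ (fun y : Fin 3 → ℝ => C₁ * y 0 + C₂ * y 1) x = _ := h3
  unfold pd
  rw [h4]
  fin_cases j <;> simp

/-- Explicit solution of symmetry type II in Cartesian coordinates: if
`(m v₁')' = C₁` and `(m v₂')' = C₂`, then `u(x) = (v₁(x₃), v₂(x₃), 0)`,
`ρ(x) = η(x₃)`, `μ(x) = m(x₃)`, `Π(x) = C₁x₁ + C₂x₂` solve the stationary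
inhomogeneous incompressible Navier–Stokes equations with zero external force:
`Σⱼ ∂ⱼ(ρ uᵢ uⱼ) − Σⱼ ∂ⱼ(μ(∂ⱼuᵢ + ∂ᵢuⱼ)) + ∂ᵢΠ = 0`, `div u = 0`, `div(ρu) = 0`. -/
theorem explicit_solution_typeII_cartesian
    (η m v₁ v₂ : ℝ → ℝ) (C₁ C₂ : ℝ)
    (hη : ContDiff ℝ 1 η) (hm : ContDiff ℝ 1 m)
    (hv₁ : ContDiff ℝ 1 v₁) (hv₂ : ContDiff ℝ 1 v₂)
    (hd₁ : Differentiable ℝ (fun t => m t * deriv v₁ t))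
    (hd₂ : Differentiable ℝ (fun t => m t * deriv v₂ t))
    (hC₁ : ∀ t, deriv (fun s => m s * deriv v₁ s) t = C₁)
    (hC₂ : ∀ t, deriv (fun s => m s * deriv v₂ s) t = C₂)
    (u : (Fin 3 → ℝ) → (Fin 3 → ℝ)) (ρ μ press : (Fin 3 → ℝ) → ℝ)
    (hu : ∀ x, u x = ![v₁ (x 2), v₂ (x 2), 0])
    (hρ : ∀ x, ρ x = η (x 2))
    (hμ : ∀ x, μ x = m (x 2))
    (hpress : ∀ x, press x = C₁ * x 0 + C₂ * x 1) :
    (∀ (i : Fin 3) (x : Fin 3 → ℝ),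
      (∑ j, pd j (fun y => ρ y * u y i * u y j) x)
        - (∑ j, pd j (fun y =>
            μ y * (pd j (fun z => u z i) y + pd i (fun z => u z j) y)) x)
        + pd i press x = 0)
    ∧ (∀ x, div3 u x = 0)
    ∧ (∀ x, div3 (fun y => ρ y • u y) x = 0) := by
  obtain rfl : u = fun x => ![v₁ (x 2), v₂ (x 2), 0] := funext hu
  obtain rfl : ρ = fun x => η (x 2) := funext hρ
  obtain rfl : μ = fun x => m (x 2) := funext hμ
  obtain rfl : press = fun x => C₁ * x 0 + C₂ * x 1 := funext hpress
  have dη := hη.differentiable one_ne_zero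
  have d1 := hv₁.differentiable one_ne_zero
  have d2 := hv₂.differentiable one_ne_zero
  have p1 := pd_comp v₁ d1
  have p2 := pd_comp v₂ d2
  have q1 := pd_comp _ hd₁
  have q2 := pd_comp _ hd₂
  have r1 := pd_comp (fun t => η t * v₁ t) (dη.mul d1)
  have r2 := pd_comp (fun t => η t * v₂ t) (dη.mul d2)
  have r11 := pd_comp (fun t => η t * v₁ t * v₁ t) ((dη.mul d1).mul d1)
  have r12 := pd_comp (fun t => η t * v₁ t * v₂ t) ((dη.mul d1).mul d2)
  have r21 := pd_comp (fun t => η t * v₂ t * v₁ t) ((dη.mul d2).mul d1)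
  have r22 := pd_comp (fun t => η t * v₂ t * v₂ t) ((dη.mul d2).mul d2)
  refine ⟨fun i x => ?_, fun x => ?_, fun x => ?_⟩
  · rw [pd_lin]
    fin_cases i <;>
      simp [Fin.sum_univ_three, p1, p2, q1, q2, r11, r12, r21, r22, pd_zero, hC₁, hC₂]
  · simp [div3, Fin.sum_univ_three, p1, p2, pd_zero]
  · simp [div3, Fin.sum_univ_three, r1, r2, pd_zero]
end
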